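/- arXiv:1311.1382 — 2 statements merged into one kernel-verified Lean document; each statement's English description precedes it below -/
import Mathlib

section
/- (Gordon's lemma, fixed ends.) Let k ≥ 1 be an integer, let t₁ < t₂ be real numbers and a > 0. Let x : [t₁,t₂] → ℝᵏ be absolutely continuous with derivative ẋ square-integrable on [t₁,t₂], and suppose x(t₁) = x(t₂) = 0. Then ∫_{t₁}^{t₂} ( (1/2)|ẋ(t)|² + a/|x(t)| ) dt ≥ (3/2)·(2π)^{2/3}·a^{2/3}·(t₂−t₁)^{1/3}, where the integral is an extended-real Lebesgue integral (the term a/|x(t)| is +∞ where x(t) = 0). -/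
open MeasureTheory Real

/-- A function whose increments are dominated by those of an absolutely continuous function is
absolutely continuous. -/
theorem AbsolutelyContinuousOnInterval.of_dist_le {X Y : Type*} [PseudoMetricSpace X]
    [PseudoMetricSpace Y] {f : ℝ → X} {g : ℝ → Y} {a b : ℝ} (C : ℝ)
    (hg : AbsolutelyContinuousOnInterval g a b)
    (h : ∀ s ∈ Set.uIcc a b, ∀ t ∈ Set.uIcc a b, dist (f s) (f t) ≤ C * dist (g s) (g t)) :
    AbsolutelyContinuousOnInterval f a b := by
  unfold AbsolutelyContinuousOnInterval at hg ⊢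
  refine squeeze_zero' (.of_forall fun _ ↦ Finset.sum_nonneg fun _ _ ↦ dist_nonneg) ?_
    (by simpa using hg.const_mul C)
  rw [Filter.eventually_inf_principal]
  refine .of_forall fun E hE ↦ ?_
  rw [Finset.mul_sum]
  exact Finset.sum_le_sum fun i hi ↦ h _ (hE.1 i hi).1 _ (hE.1 i hi).2

/-- The calibration argument: `-2 c r tan φ` with `φ' = c / r` bounds the kinetic term from
below. -/
theorem two_mul_sq_mul_le_integral_of_mul_lt_pi {t₁ t₂ : ℝ} (ht : t₁ < t₂) {r w : ℝ → ℝ}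
    (hr : AbsolutelyContinuousOnInterval r t₁ t₂) (hr₀ : ∀ t, 0 ≤ r t)
    (hpos : ∀ᵐ t, t ∈ Set.Icc t₁ t₂ → 0 < r t)
    (h1 : r t₁ = 0) (h2 : r t₂ = 0)
    (hinv : IntervalIntegrable (fun t ↦ (r t)⁻¹) volume t₁ t₂)
    (hw : IntervalIntegrable w volume t₁ t₂)
    (hrw : ∀ᵐ t, t ∈ Set.Icc t₁ t₂ → deriv r t ^ 2 ≤ w t)
    {c : ℝ} (hc : 0 < c) (hcS : c * (∫ t in t₁..t₂, (r t)⁻¹) < π) :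
    2 * c ^ 2 * (t₂ - t₁) ≤ ∫ t in t₁..t₂, (1 / 2) * w t := by
  set S := ∫ t in t₁..t₂, (r t)⁻¹
  have hu : Set.uIcc t₁ t₂ = Set.Icc t₁ t₂ := Set.uIcc_of_le ht.le
  set φ : ℝ → ℝ := fun t ↦ c * ((∫ s in t₁..t, (r s)⁻¹) - S / 2) with hφ
  have hIac : AbsolutelyContinuousOnInterval (fun t ↦ ∫ s in t₁..t, (r s)⁻¹) t₁ t₂ :=
    hinv.absolutelyContinuousOnInterval_intervalIntegral Set.left_mem_uIcc
  have hφmem : ∀ t ∈ Set.uIcc t₁ t₂, φ t ∈ Set.Icc (-(c * S / 2)) (c * S / 2) := by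
    intro t htm
    have htm' := htm
    rw [hu] at htm'
    have i1 : IntervalIntegrable (fun t ↦ (r t)⁻¹) volume t₁ t :=
      hinv.mono_set (Set.uIcc_subset_uIcc Set.left_mem_uIcc htm)
    have i2 : IntervalIntegrable (fun t ↦ (r t)⁻¹) volume t t₂ :=
      hinv.mono_set (Set.uIcc_subset_uIcc htm Set.right_mem_uIcc)
    have e : (∫ s in t₁..t, (r s)⁻¹) + (∫ s in t..t₂, (r s)⁻¹) = S :=
      intervalIntegral.integral_add_adjacent_intervals i1 i2
    have p1 : 0 ≤ ∫ s in t₁..t, (r s)⁻¹ :=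
      intervalIntegral.integral_nonneg htm'.1 fun s _ ↦ inv_nonneg.2 (hr₀ s)
    have p2 : 0 ≤ ∫ s in t..t₂, (r s)⁻¹ :=
      intervalIntegral.integral_nonneg htm'.2 fun s _ ↦ inv_nonneg.2 (hr₀ s)
    constructor <;> simp only [hφ] <;> nlinarith
  have hcos : ∀ u ∈ Set.Icc (-(c * S / 2)) (c * S / 2), cos u ≠ 0 := fun u hu ↦
    (cos_pos_of_mem_Ioo ⟨by linarith [hu.1], by linarith [hu.2]⟩).ne'
  have htan : AbsolutelyContinuousOnInterval (fun t ↦ tan (φ t)) t₁ t₂ := by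
    have hcd : ContDiffOn ℝ 1 tan (Set.Icc (-(c * S / 2)) (c * S / 2)) := fun u hu ↦
      (contDiffAt_tan.2 (hcos u hu)).contDiffWithinAt
    obtain ⟨K, hK⟩ := hcd.exists_lipschitzOnWith (by decide) (convex_Icc _ _) isCompact_Icc
    refine .of_dist_le (K * c) hIac fun s hs t ht' ↦ ?_
    refine (hK.dist_le_mul _ (hφmem s hs) _ (hφmem t ht')).trans_eq ?_
    rw [mul_assoc]
    congr 1
    simp only [hφ, Real.dist_eq, ← mul_sub, abs_mul, abs_of_pos hc]
    congr 2
    ring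
  have hF := hr.mul htan
  have hF0 : ∫ t in t₁..t₂, deriv (r * fun t ↦ tan (φ t)) t = 0 := by
    rw [hF.integral_deriv_eq_sub]
    simp [h1, h2]
  have hFi := hF.intervalIntegrable_deriv
  have key : ∫ t in t₁..t₂, (2 * c ^ 2 - 2 * c * deriv (r * fun t ↦ tan (φ t)) t)
      ≤ ∫ t in t₁..t₂, (1 / 2) * w t := by
    refine intervalIntegral.integral_mono_ae_restrict ht.le
      (intervalIntegrable_const.sub (hFi.const_mul _)) (hw.const_mul _) ?_
    rw [Filter.EventuallyLE, ae_restrict_iff' measurableSet_Icc]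
    filter_upwards [hpos, hrw, hr.ae_differentiableAt, hinv.ae_hasDerivAt_integral]
      with t hp hwt hrd hId htm
    have htu : t ∈ Set.uIcc t₁ t₂ := hu ▸ htm
    have hφd : HasDerivAt φ (c * (r t)⁻¹) t :=
      ((hId htu t₁ Set.left_mem_uIcc).sub_const _).const_mul c
    have hd := (hrd htu).hasDerivAt.mul
      ((hasDerivAt_tan (hcos _ (hφmem t htu))).comp t hφd)
    have hd' : deriv (r * fun t ↦ tan (φ t)) t
        = deriv r t * tan (φ t) + c * (1 + tan (φ t) ^ 2) := by
      refine hd.deriv.trans ?_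
      have h3 := inv_one_add_tan_sq (hcos _ (hφmem t htu))
      have h4 : 1 / cos (φ t) ^ 2 = 1 + tan (φ t) ^ 2 := by rw [← h3]; simp
      rw [h4]
      have := (hp htm).ne'
      simp only [Function.comp]
      field_simp
    rw [hd']
    nlinarith [sq_nonneg (deriv r t + 2 * c * tan (φ t)), hwt htm]
  rwa [intervalIntegral.integral_sub intervalIntegrable_const (hFi.const_mul _),
    intervalIntegral.integral_const_mul (2 * c) (deriv _), hF0, intervalIntegral.integral_const,
    smul_eq_mul, mul_zero, sub_zero, mul_comm] at key

/-- The sharp bound for the kinetic term in terms of `∫ 1 / r`. -/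
theorem two_mul_pi_sq_mul_le {t₁ t₂ S A : ℝ} (hS : 0 < S)
    (h : ∀ c : ℝ, 0 < c → c * S < π → 2 * c ^ 2 * (t₂ - t₁) ≤ A) :
    2 * π ^ 2 * (t₂ - t₁) ≤ A * S ^ 2 := by
  have hlim : Filter.Tendsto (fun c : ℝ ↦ 2 * c ^ 2 * (t₂ - t₁)) (nhdsWithin (π / S) (Set.Iio (π / S)))
      (nhds (2 * (π / S) ^ 2 * (t₂ - t₁))) :=
    (Continuous.tendsto (by fun_prop) _).mono_left nhdsWithin_le_nhds
  have := le_of_tendsto hlim (b := A) (by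
    filter_upwards [Ioo_mem_nhdsLT (div_pos pi_pos hS)] with c hc
    exact h c hc.1 ((lt_div_iff₀ hS).1 hc.2))
  have e : 2 * π ^ 2 * (t₂ - t₁) = 2 * (π / S) ^ 2 * (t₂ - t₁) * S ^ 2 := by
    field_simp
  rw [e]
  gcongr

/-- Minimization over `S` of the reduced action `2 π² T / S² + a S`. -/
theorem gordon_const_le_add {a T S A : ℝ} (ha : 0 < a) (hT : 0 < T) (hS : 0 < S) (hA : 0 ≤ A)
    (h : 2 * π ^ 2 * T ≤ A * S ^ 2) :
    (3 / 2) * (2 * π) ^ ((2:ℝ)/3) * a ^ ((2:ℝ)/3) * T ^ ((1:ℝ)/3) ≤ A + a * S := by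
  have hpi := pi_pos
  have cube : ∀ x : ℝ, 0 ≤ x → ∀ n : ℕ, (x ^ ((n:ℝ)/3)) ^ 3 = x ^ n := fun x hx n ↦ by
    rw [← Real.rpow_natCast, ← Real.rpow_mul hx, ← Real.rpow_natCast]
    congr 1
    push_cast
    ring
  have c1 := cube (2 * π) (by positivity) 2
  have c2 := cube a ha.le 2
  have c3 := cube T hT.le 1
  push_cast at c1 c2 c3
  refine le_of_pow_le_pow_left₀ (n := 3) (by norm_num) (by positivity) ?_
  rw [mul_pow, mul_pow, mul_pow, c1, c2, c3]
  have hm : 0 < a * S := by positivity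
  have amgm : 27 / 4 * (A * (a * S) ^ 2) ≤ (A + a * S) ^ 3 := by
    nlinarith [mul_nonneg (add_nonneg hA (by positivity : 0 ≤ 4 * (a * S)))
      (sq_nonneg (2 * A - a * S))]
  have := mul_le_mul_of_nonneg_left h (sq_nonneg a)
  nlinarith

/-- Gordon's lemma with fixed ends: if `x : [t₁,t₂] → ℝᵏ` is absolutely continuous with
square-integrable derivative `x'` and `x(t₁) = x(t₂) = 0`, then
`∫ (1/2)|x'|² + a/|x| ≥ (3/2) (2π)^{2/3} a^{2/3} (t₂-t₁)^{1/3}`. -/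
theorem stmt6 (k : ℕ) (hk : 1 ≤ k) (t₁ t₂ : ℝ) (ht : t₁ < t₂) (a : ℝ) (ha : 0 < a)
    (x x' : ℝ → EuclideanSpace ℝ (Fin k))
    (hAC : ∀ t ∈ Set.Icc t₁ t₂, x t = x t₁ + ∫ s in t₁..t, x' s)
    (hL1 : IntegrableOn x' (Set.Icc t₁ t₂))
    (hL2 : IntegrableOn (fun t => ‖x' t‖ ^ 2) (Set.Icc t₁ t₂))
    (h1 : x t₁ = 0) (h2 : x t₂ = 0) :
    ENNReal.ofReal ((3 / 2) * (2 * π) ^ ((2:ℝ)/3) * a ^ ((2:ℝ)/3) * (t₂ - t₁) ^ ((1:ℝ)/3))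
      ≤ ∫⁻ t in Set.Icc t₁ t₂,
          ENNReal.ofReal ((1 / 2) * ‖x' t‖ ^ 2) + ENNReal.ofReal a / ENNReal.ofReal ‖x t‖ := by
  have hu : Set.uIcc t₁ t₂ = Set.Icc t₁ t₂ := Set.uIcc_of_le ht.le
  have hi : IntervalIntegrable x' volume t₁ t₂ :=
    (intervalIntegrable_iff_integrableOn_Icc_of_le ht.le).2 hL1
  have hi2 : IntervalIntegrable (fun t ↦ ‖x' t‖ ^ 2) volume t₁ t₂ :=
    (intervalIntegrable_iff_integrableOn_Icc_of_le ht.le).2 hL2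
  set y : ℝ → EuclideanSpace ℝ (Fin k) := fun t ↦ ∫ s in t₁..t, x' s with hy
  have hxy : ∀ t ∈ Set.Icc t₁ t₂, x t = y t := fun t h ↦ by rw [hAC t h, h1, zero_add]
  have hrac : AbsolutelyContinuousOnInterval (fun t ↦ ‖y t‖) t₁ t₂ := by
    refine .of_dist_le 1
      (hi.norm.absolutelyContinuousOnInterval_intervalIntegral Set.left_mem_uIcc) ?_
    intro s hs t ht'
    have is := hi.mono_set (Set.uIcc_subset_uIcc Set.left_mem_uIcc hs)
    have it := hi.mono_set (Set.uIcc_subset_uIcc Set.left_mem_uIcc ht')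
    rw [one_mul, Real.dist_eq, Real.dist_eq,
      intervalIntegral.integral_interval_sub_left is.norm it.norm]
    refine (abs_norm_sub_norm_le _ _).trans ?_
    simp only [hy]
    rw [intervalIntegral.integral_interval_sub_left is it]
    exact intervalIntegral.norm_integral_le_abs_integral_norm
  have hrc : ContinuousOn (fun t ↦ ‖y t‖) (Set.Icc t₁ t₂) := hu ▸ hrac.continuousOn
  have hrm : AEMeasurable (fun t ↦ ‖y t‖) (volume.restrict (Set.Icc t₁ t₂)) :=
    hrc.aemeasurable measurableSet_Icc
  have hsplit : ∫⁻ t in Set.Icc t₁ t₂,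
        ENNReal.ofReal ((1 / 2) * ‖x' t‖ ^ 2) + ENNReal.ofReal a / ENNReal.ofReal ‖x t‖
      = ENNReal.ofReal (∫ t in t₁..t₂, (1 / 2) * ‖x' t‖ ^ 2)
        + ENNReal.ofReal a * ∫⁻ t in Set.Icc t₁ t₂, (ENNReal.ofReal ‖y t‖)⁻¹ := by
    rw [lintegral_add_left' (hL2.const_mul (1 / 2)).1.aemeasurable.ennreal_ofReal,
      intervalIntegral.integral_of_le ht.le, ← integral_Icc_eq_integral_Ioc,
      ofReal_integral_eq_lintegral_ofReal (hL2.const_mul (1 / 2))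
        (.of_forall fun t ↦ by positivity),
      ← lintegral_const_mul' _ _ ENNReal.ofReal_ne_top]
    congr 1
    refine setLIntegral_congr_fun measurableSet_Icc fun t h ↦ ?_
    simp only [hxy t h, div_eq_mul_inv]
  rw [hsplit]
  by_cases htop : ∫⁻ t in Set.Icc t₁ t₂, (ENNReal.ofReal ‖y t‖)⁻¹ = ⊤
  · rw [htop, ENNReal.mul_top (by simpa using ha)]
    simp
  have hpos : ∀ᵐ t, t ∈ Set.Icc t₁ t₂ → 0 < ‖y t‖ := by
    have := ae_lt_top' hrm.ennreal_ofReal.inv htop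
    rw [ae_restrict_iff' measurableSet_Icc] at this
    filter_upwards [this] with t h htm
    simpa using h htm
  have hlint : ∫⁻ t in Set.Icc t₁ t₂, (ENNReal.ofReal ‖y t‖)⁻¹
      = ∫⁻ t in Set.Icc t₁ t₂, ENNReal.ofReal (‖y t‖⁻¹) := by
    refine setLIntegral_congr_fun_ae measurableSet_Icc ?_
    filter_upwards [hpos] with t h htm
    rw [ENNReal.ofReal_inv_of_pos (h htm)]
  have hinv : IntegrableOn (fun t ↦ ‖y t‖⁻¹) (Set.Icc t₁ t₂) := by
    refine ⟨hrm.inv.aestronglyMeasurable, ?_⟩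
    rw [hasFiniteIntegral_iff_ofReal (.of_forall fun t ↦ by positivity), ← hlint]
    exact lt_top_iff_ne_top.2 htop
  have hinv' : IntervalIntegrable (fun t ↦ ‖y t‖⁻¹) volume t₁ t₂ :=
    (intervalIntegrable_iff_integrableOn_Icc_of_le ht.le).2 hinv
  have hlS : ∫⁻ t in Set.Icc t₁ t₂, (ENNReal.ofReal ‖y t‖)⁻¹
      = ENNReal.ofReal (∫ t in t₁..t₂, ‖y t‖⁻¹) := by
    rw [hlint, intervalIntegral.integral_of_le ht.le, ← integral_Icc_eq_integral_Ioc,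
      ofReal_integral_eq_lintegral_ofReal hinv (.of_forall fun t ↦ by positivity)]
  have hS : 0 < ∫ t in t₁..t₂, ‖y t‖⁻¹ := by
    rw [intervalIntegral.integral_pos_iff_support_of_nonneg_ae
      (.of_forall fun t ↦ inv_nonneg.2 (norm_nonneg _)) hinv']
    refine ⟨ht, (by simpa using ht : 0 < volume (Set.Ioc t₁ t₂)).trans_le (measure_mono_ae ?_)⟩
    filter_upwards [hpos] with t h htm
    exact ⟨(inv_pos.2 (h (Set.Ioc_subset_Icc_self htm))).ne', htm⟩
  have hA : 0 ≤ ∫ t in t₁..t₂, (1 / 2) * ‖x' t‖ ^ 2 :=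
    intervalIntegral.integral_nonneg ht.le fun t _ ↦ by positivity
  have hder : ∀ᵐ t, t ∈ Set.Icc t₁ t₂ → deriv (fun t ↦ ‖y t‖) t ^ 2 ≤ ‖x' t‖ ^ 2 := by
    filter_upwards [hpos, hrac.ae_differentiableAt, hi.ae_hasDerivAt_integral]
      with t hp hd hyd htm
    have htu : t ∈ Set.uIcc t₁ t₂ := hu ▸ htm
    have e1 := (hyd htu t₁ Set.left_mem_uIcc).norm_sq
    have e2 := (hd htu).hasDerivAt.pow 2
    have e := e1.unique e2
    have hcs := abs_real_inner_le_norm (y t) (x' t)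
    have hp' := hp htm
    have e' : inner ℝ (y t) (x' t) = ‖y t‖ * deriv (fun t ↦ ‖y t‖) t := by
      norm_num at e
      linarith
    rw [e', abs_mul, abs_of_pos hp'] at hcs
    exact sq_le_sq.2 ((le_of_mul_le_mul_left hcs hp').trans_eq (abs_norm _).symm)
  have hy1 : ‖y t₁‖ = 0 := by simp [hy]
  have hy2 : ‖y t₂‖ = 0 := by rw [← hxy t₂ (Set.right_mem_Icc.2 ht.le), h2, norm_zero]
  rw [hlS, ← ENNReal.ofReal_mul ha.le, ← ENNReal.ofReal_add hA (by positivity)]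
  refine ENNReal.ofReal_le_ofReal (gordon_const_le_add ha (sub_pos.2 ht) hS hA ?_)
  exact two_mul_pi_sq_mul_le hS fun c hc hcS ↦
    two_mul_sq_mul_le_integral_of_mul_lt_pi ht hrac (fun t ↦ norm_nonneg _) hpos hy1 hy2
      hinv' hi2 hder hc hcS
end

section
/- (Gordon bound for a function periodic of period 1/k with zero mean per period.) Let n ≥ 1 and k ≥ 1 be integers and a > 0. Let x : ℝ → ℝⁿ be (1/k)-periodic, absolutely continuous with derivative ẋ square-integrable on [0,1], and suppose ∫₀^{1/k} x(t) dt = 0. Then ∫₀¹ ( (1/2)|ẋ(t)|² + a/|x(t)| ) dt ≥ (3/2)·(2π)^{2/3}·a^{2/3}·k^{2/3}, where the integral is an extended-real Lebesgue integral (the term a/|x(t)| is +∞ where x(t) = 0). -/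
open MeasureTheory Real

/-- Integration by parts of a primitive of an integrable function against a `C¹` function. -/
lemma integral_mul_eq_sub_of_primitive {f g u u' : ℝ → ℝ} {a b : ℝ} (hab : a ≤ b)
    (hg : IntervalIntegrable g volume a b)
    (hf : ∀ t ∈ Set.Icc a b, f t = f a + ∫ s in a..t, g s)
    (hu : ∀ t, HasDerivAt u (u' t) t) (hu' : Continuous u') :
    ∫ t in a..b, u t * g t = u b * f b - u a * f a - ∫ t in a..b, u' t * f t := by
  set F : ℝ → ℝ := fun t => f a + ∫ s in a..t, g s with hF
  have hderiv : deriv u = u' := funext fun t => (hu t).deriv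
  have huC : ContDiff ℝ 1 u := by
    rw [contDiff_one_iff_deriv]
    exact ⟨fun t => (hu t).differentiableAt, hderiv ▸ hu'⟩
  have hFac : AbsolutelyContinuousOnInterval F a b :=
    (contDiff_const.contDiffOn.absolutelyContinuousOnInterval).fun_add
      (hg.absolutelyContinuousOnInterval_intervalIntegral (by simp))
  have key := huC.contDiffOn.absolutelyContinuousOnInterval.integral_mul_deriv_eq_deriv_mul hFac
  have hl : ∫ t in a..b, u t * g t = ∫ t in a..b, u t * deriv F t := by
    apply intervalIntegral.integral_congr_ae
    filter_upwards [hg.ae_hasDerivAt_integral] with t ht htI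
    have := (ht (Set.uIoc_subset_uIcc htI) a (by simp)).const_add (f a)
    rw [hF, this.deriv]
  have hr : ∫ t in a..b, u' t * f t = ∫ t in a..b, deriv u t * F t := by
    apply intervalIntegral.integral_congr
    intro t ht
    rw [Set.uIcc_of_le hab] at ht
    simp only [hderiv, hF]
    rw [hf t ht]
  rw [hl, hr, key, hf b ⟨hab, le_rfl⟩]
  simp [hF]

/-- A primitive of an integrable function is continuous. -/
lemma continuousOn_of_primitive {E : Type*} [NormedAddCommGroup E] [NormedSpace ℝ E]
    {f g : ℝ → E} {a b : ℝ} (hg : IntegrableOn g (Set.Icc a b))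
    (hf : ∀ t ∈ Set.Icc a b, f t = f a + ∫ s in a..t, g s) :
    ContinuousOn f (Set.Icc a b) := by
  refine ContinuousOn.congr ((continuousOn_const (c := f a)).add
    (intervalIntegral.continuousOn_primitive hg)) fun t ht => ?_
  rw [hf t ht, intervalIntegral.integral_of_le ht.1]
  rfl

/-- Complex-valued version of `integral_mul_eq_sub_of_primitive`. -/
lemma integral_mul_ofReal_eq_sub_of_primitive {f g : ℝ → ℝ} {u u' : ℝ → ℂ} {a b : ℝ}
    (hab : a ≤ b) (hg : IntervalIntegrable g volume a b)
    (hf : ∀ t ∈ Set.Icc a b, f t = f a + ∫ s in a..t, g s)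
    (hu : ∀ t, HasDerivAt u (u' t) t) (hu' : Continuous u') :
    ∫ t in a..b, u t * (g t : ℂ) = u b * f b - u a * f a - ∫ t in a..b, u' t * (f t : ℂ) := by
  have huc : Continuous u := continuous_iff_continuousAt.2 fun t => (hu t).continuousAt
  have hfc : ContinuousOn f (Set.uIcc a b) := by
    rw [Set.uIcc_of_le hab]
    exact continuousOn_of_primitive
      ((intervalIntegrable_iff_integrableOn_Icc_of_le hab).1 hg) hf
  have h₁ : IntervalIntegrable (fun t => u t * (g t : ℂ)) volume a b :=
    IntervalIntegrable.continuousOn_mul ⟨hg.1.ofReal, hg.2.ofReal⟩ huc.continuousOn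
  have h₂ : IntervalIntegrable (fun t => u' t * (f t : ℂ)) volume a b :=
    (hu'.continuousOn.mul (Complex.continuous_ofReal.comp_continuousOn hfc)).intervalIntegrable
  have hre := integral_mul_eq_sub_of_primitive hab hg hf (u := fun t => (u t).re)
    (u' := fun t => (u' t).re) (fun t => Complex.reCLM.hasFDerivAt.comp_hasDerivAt t (hu t))
    (Complex.continuous_re.comp hu')
  have him := integral_mul_eq_sub_of_primitive hab hg hf (u := fun t => (u t).im)
    (u' := fun t => (u' t).im) (fun t => Complex.imCLM.hasFDerivAt.comp_hasDerivAt t (hu t))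
    (Complex.continuous_im.comp hu')
  have r₁ := Complex.reCLM.intervalIntegral_comp_comm h₁
  have r₂ := Complex.reCLM.intervalIntegral_comp_comm h₂
  have i₁ := Complex.imCLM.intervalIntegral_comp_comm h₁
  have i₂ := Complex.imCLM.intervalIntegral_comp_comm h₂
  simp only [Complex.reCLM_apply, Complex.imCLM_apply, Complex.re_mul_ofReal,
    Complex.im_mul_ofReal] at r₁ r₂ i₁ i₂
  apply Complex.ext
  · simp only [Complex.sub_re, Complex.re_mul_ofReal, ← r₁, ← r₂, hre]
  · simp only [Complex.sub_im, Complex.im_mul_ofReal, ← i₁, ← i₂, him]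

lemma fourierCoeffOn_zero_one {E : Type*} [NormedAddCommGroup E] [NormedSpace ℂ E]
    (f : ℝ → E) (m : ℤ) :
    fourierCoeffOn zero_lt_one f m
      = ∫ t in (0:ℝ)..1, Complex.exp (-2 * π * Complex.I * m * t) • f t := by
  rw [fourierCoeffOn_eq_integral]
  simp_rw [fourier_coe_apply]
  simp

lemma fourierCoeffOn_derivative {f g : ℝ → ℝ}
    (hg : IntervalIntegrable g volume 0 1)
    (hf : ∀ t ∈ Set.Icc (0:ℝ) 1, f t = f 0 + ∫ s in (0:ℝ)..t, g s)
    (hf01 : f 1 = f 0) (m : ℤ) :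
    fourierCoeffOn zero_lt_one (fun t => (g t : ℂ)) m
      = 2 * π * Complex.I * m * fourierCoeffOn zero_lt_one (fun t => (f t : ℂ)) m := by
  set c : ℂ := -2 * π * Complex.I * m with hc
  have hu : ∀ t : ℝ, HasDerivAt (fun t : ℝ => Complex.exp (c * t)) (c * Complex.exp (c * t)) t := by
    intro t
    have h := ((Complex.ofRealCLM.hasDerivAt (x := t)).const_mul c).cexp
    simpa [mul_comm] using h
  have h1 : Complex.exp (c * (1 : ℝ)) = 1 := by
    rw [Complex.exp_eq_one_iff]
    exact ⟨-m, by rw [hc]; push_cast; ring⟩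
  have key := integral_mul_ofReal_eq_sub_of_primitive zero_le_one hg hf hu (by fun_prop)
  rw [fourierCoeffOn_zero_one, fourierCoeffOn_zero_one]
  simp only [smul_eq_mul, ← hc]
  rw [key, h1, hf01]
  simp only [mul_assoc c, intervalIntegral.integral_const_mul]
  simp [hc]

lemma fourierCoeffOn_eq_zero_of_periodic {f : ℝ → ℂ} {k : ℕ} (hk : k ≠ 0)
    (hper : Function.Periodic f (1 / k)) {m : ℤ} (hm : ¬ (k : ℤ) ∣ m) :
    fourierCoeffOn zero_lt_one f m = 0 := by
  set c : ℂ := -2 * π * Complex.I * m with hc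
  have hk' : (k : ℂ) ≠ 0 := by exact_mod_cast hk
  have hkR : (k : ℝ) ≠ 0 := by exact_mod_cast hk
  set h : ℝ → ℂ := fun t => Complex.exp (c * t) • f t with hh
  have hf1 : Function.Periodic f 1 := by
    have := hper.nat_mul k
    rwa [mul_one_div_cancel hkR] at this
  have hh1 : Function.Periodic h 1 := by
    intro t
    have h1 : Complex.exp c = 1 := by
      rw [Complex.exp_eq_one_iff]
      exact ⟨-m, by rw [hc]; push_cast; ring⟩
    simp only [hh, hf1 t]
    push_cast
    rw [mul_add, Complex.exp_add, mul_one, h1, mul_one]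
  have hshift : ∀ t, h (t + 1 / k) = Complex.exp (c / k) * h t := by
    intro t
    simp only [hh, hper t, smul_eq_mul]
    push_cast
    rw [mul_add, Complex.exp_add, mul_one_div]
    ring
  have hI : ∫ t in (0:ℝ)..1, h t = Complex.exp (c / k) * ∫ t in (0:ℝ)..1, h t := by
    rw [← intervalIntegral.integral_const_mul]
    simp only [← hshift]
    rw [intervalIntegral.integral_comp_add_right]
    have := hh1.intervalIntegral_add_eq 0 (1 / k)
    rw [zero_add] at this
    rw [this, zero_add, add_comm (1 : ℝ)]
  have hne : Complex.exp (c / k) ≠ 1 := by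
    rw [Ne, Complex.exp_eq_one_iff]
    rintro ⟨j, hj⟩
    apply hm
    refine ⟨-j, ?_⟩
    have h2 : (2 * π * Complex.I) ≠ 0 := Complex.two_pi_I_ne_zero
    rw [div_eq_iff hk', hc] at hj
    have : (m : ℂ) = k * (-j) := by
      apply mul_left_cancel₀ h2
      linear_combination -hj
    exact_mod_cast this
  rw [fourierCoeffOn_zero_one]
  have h0 : (1 - Complex.exp (c / k)) * ∫ t in (0:ℝ)..1, h t = 0 := by
    linear_combination hI
  exact (mul_eq_zero.1 h0).resolve_left (sub_ne_zero.2 hne.symm)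

/-- **Wirtinger's inequality** for a real function of period `1 / k` with zero mean. -/
lemma wirtinger_of_periodic {f g : ℝ → ℝ} {k : ℕ} (hk : k ≠ 0)
    (hper : Function.Periodic f (1 / k))
    (hg : MemLp g 2 (volume.restrict (Set.Ioc 0 1)))
    (hf : ∀ t ∈ Set.Icc (0:ℝ) 1, f t = f 0 + ∫ s in (0:ℝ)..t, g s)
    (hmean : ∫ t in (0:ℝ)..(1 / k : ℝ), f t = 0) :
    (2 * π * k) ^ 2 * ∫ t in (0:ℝ)..1, f t ^ 2 ≤ ∫ t in (0:ℝ)..1, g t ^ 2 := by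
  have hkR : (k : ℝ) ≠ 0 := by exact_mod_cast hk
  have hf1 : Function.Periodic f 1 := by
    have := hper.nat_mul k
    rwa [mul_one_div_cancel hkR] at this
  have hf01 : f 1 = f 0 := by simpa using hf1 0
  have hgI : IntervalIntegrable g volume 0 1 := by
    rw [intervalIntegrable_iff_integrableOn_Ioc_of_le zero_le_one]
    exact hg.integrable (by norm_num)
  have hfc : ContinuousOn f (Set.Icc 0 1) := continuousOn_of_primitive
    ((intervalIntegrable_iff_integrableOn_Icc_of_le zero_le_one).1 hgI) hf
  have hfI : IntervalIntegrable f volume 0 1 := by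
    apply ContinuousOn.intervalIntegrable
    rwa [Set.uIcc_of_le zero_le_one]
  have hfL : MemLp (fun t => (f t : ℂ)) 2 (volume.restrict (Set.Ioc 0 1)) := by
    obtain ⟨C, hC⟩ := isCompact_Icc.exists_bound_of_continuousOn hfc
    refine MemLp.of_bound (C := C) ?_ ?_
    · rw [intervalIntegrable_iff_integrableOn_Ioc_of_le zero_le_one] at hfI
      exact Complex.continuous_ofReal.comp_aestronglyMeasurable hfI.aestronglyMeasurable
    · filter_upwards [ae_restrict_mem measurableSet_Ioc] with t ht
      simpa using hC t (Set.Ioc_subset_Icc_self ht)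
  have hmean1 : ∫ t in (0:ℝ)..1, f t = 0 := by
    have := hper.intervalIntegral_add_zsmul_eq (k : ℤ) 0
      (hf1.intervalIntegrable one_ne_zero (t := 0) (by simpa using hfI))
    simp only [zero_add, hmean, smul_zero, natCast_zsmul, nsmul_eq_mul,
      mul_one_div_cancel hkR] at this
    exact this
  have hmean0 : fourierCoeffOn zero_lt_one (fun t => (f t : ℂ)) 0 = 0 := by
    rw [fourierCoeffOn_zero_one]
    simp [intervalIntegral.integral_ofReal, hmean1]
  have hsf := hasSum_sq_fourierCoeffOn zero_lt_one hfL
  have hsg := hasSum_sq_fourierCoeffOn zero_lt_one hg.ofReal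
  simp only [sub_zero, inv_one, one_smul, Complex.norm_real, Real.norm_eq_abs, sq_abs,
    Complex.coe_algebraMap] at hsf hsg
  refine hasSum_le (fun m => ?_) (hsf.mul_left ((2 * π * k) ^ 2)) hsg
  by_cases hm : (k : ℤ) ∣ m ∧ m ≠ 0
  · obtain ⟨⟨j, rfl⟩, hm0⟩ := hm
    rw [fourierCoeffOn_derivative hgI hf hf01, norm_mul, mul_pow ‖_‖]
    gcongr
    simp only [norm_mul, Complex.norm_I, Complex.norm_real, Complex.norm_intCast, mul_one,
      Complex.norm_ofNat, Real.norm_eq_abs, abs_of_pos pi_pos]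
    gcongr
    have hj : j ≠ 0 := by rintro rfl; simp at hm0
    have : (1 : ℝ) ≤ |(j : ℝ)| := by exact_mod_cast Int.one_le_abs hj
    push_cast
    rw [abs_mul, Nat.abs_cast]
    nlinarith [(Nat.cast_nonneg k : (0:ℝ) ≤ k)]
  · have : fourierCoeffOn zero_lt_one (fun t => (f t : ℂ)) m = 0 := by
      by_cases hm0 : m = 0
      · rw [hm0, hmean0]
      · refine fourierCoeffOn_eq_zero_of_periodic hk (fun t => ?_) fun h => hm ⟨h, hm0⟩
        rw [hper t]
    rw [this]
    simp only [norm_zero, ne_eq, OfNat.ofNat_ne_zero, not_false_eq_true, zero_pow, mul_zero]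
    positivity

/-- **Wirtinger's inequality** for a curve of period `1 / k` with zero mean. -/
lemma wirtinger_euclideanSpace_of_periodic {ι : Type*} [Fintype ι]
    {x x' : ℝ → EuclideanSpace ℝ ι} {k : ℕ} (hk : k ≠ 0)
    (hper : Function.Periodic x (1 / k))
    (hx' : MemLp x' 2 (volume.restrict (Set.Ioc 0 1)))
    (hx : ∀ t ∈ Set.Icc (0:ℝ) 1, x t = x 0 + ∫ s in (0:ℝ)..t, x' s)
    (hmean : ∫ t in (0:ℝ)..(1 / k : ℝ), x t = 0) :
    (2 * π * k) ^ 2 * ∫ t in (0:ℝ)..1, ‖x t‖ ^ 2 ≤ ∫ t in (0:ℝ)..1, ‖x' t‖ ^ 2 := by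
  have hint : IntervalIntegrable x' volume 0 1 := by
    rw [intervalIntegrable_iff_integrableOn_Ioc_of_le zero_le_one]
    exact hx'.integrable (by norm_num)
  have hxc : ContinuousOn x (Set.Icc 0 1) := continuousOn_of_primitive
    ((intervalIntegrable_iff_integrableOn_Icc_of_le zero_le_one).1 hint) hx
  have hk1 : (1 / k : ℝ) ≤ 1 := by
    rw [div_le_one (by positivity)]
    exact_mod_cast Nat.one_le_iff_ne_zero.2 hk
  have hxI : IntervalIntegrable x volume 0 (1 / k) := by
    apply ContinuousOn.intervalIntegrable
    rw [Set.uIcc_of_le (by positivity)]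
    exact hxc.mono (Set.Icc_subset_Icc_right hk1)
  have hx'i : ∀ i, MemLp (fun t => x' t i) 2 (volume.restrict (Set.Ioc 0 1)) := fun i =>
    (EuclideanSpace.proj (𝕜 := ℝ) i).comp_memLp' hx'
  have hcoord : ∀ i, (2 * π * k) ^ 2 * ∫ t in (0:ℝ)..1, x t i ^ 2 ≤
      ∫ t in (0:ℝ)..1, x' t i ^ 2 := by
    intro i
    refine wirtinger_of_periodic hk (fun t => by rw [hper t]) (hx'i i) (fun t ht => ?_) ?_
    · have := (EuclideanSpace.proj (𝕜 := ℝ) i).intervalIntegral_comp_comm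
        (hint.mono_set (a := 0) (b := 1) (c := 0) (d := t) (by
          rw [Set.uIcc_of_le ht.1, Set.uIcc_of_le zero_le_one]
          exact Set.Icc_subset_Icc_right ht.2))
      simp only [PiLp.proj_apply] at this
      rw [this, hx t ht]
      simp
    · have := (EuclideanSpace.proj (𝕜 := ℝ) i).intervalIntegral_comp_comm hxI
      simp only [PiLp.proj_apply] at this
      rw [this, hmean]
      simp
  simp only [EuclideanSpace.norm_sq_eq, Real.norm_eq_abs, sq_abs]
  rw [intervalIntegral.integral_finsetSum, intervalIntegral.integral_finsetSum, Finset.mul_sum]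
  · exact Finset.sum_le_sum fun i _ => hcoord i
  · intro i _
    rw [intervalIntegrable_iff_integrableOn_Ioc_of_le zero_le_one]
    exact (hx'i i).integrable_sq
  · intro i _
    apply ContinuousOn.intervalIntegrable
    rw [Set.uIcc_of_le zero_le_one]
    exact ((EuclideanSpace.proj (𝕜 := ℝ) i).continuous.comp_continuousOn hxc).pow 2

lemma three_halves_mul_rpow_le {w a s : ℝ} (hw : 0 ≤ w) (ha : 0 ≤ a) (hs : 0 < s) :
    3 / 2 * (w * a) ^ ((2:ℝ)/3) ≤ w ^ 2 / 2 * s ^ 2 + a / s := by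
  set q := (w * a) ^ ((2:ℝ)/3) with hq
  have hq3 : q ^ 3 = (w * a) ^ 2 := by
    rw [hq, ← Real.rpow_natCast, ← Real.rpow_mul (by positivity), ← Real.rpow_natCast]
    norm_num
  set A := w ^ 2 * s ^ 2 with hA
  set B := a / s with hB
  have hA0 : 0 ≤ A := by positivity
  have hB0 : 0 ≤ B := by positivity
  have hAB : A * B ^ 2 = (w * a) ^ 2 := by rw [hA, hB]; field_simp
  have : 3 * q ≤ A + 2 * B := by
    refine le_of_pow_le_pow_left₀ (n := 3) (by norm_num) (by positivity) ?_
    rw [mul_pow, hq3, ← hAB]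
    nlinarith [mul_nonneg (sq_nonneg (A - B)) (by positivity : 0 ≤ A + 8 * B)]
  linarith

/-- Gordon bound for a `(1/k)`-periodic function with zero mean per period:
`∫₀¹ (1/2)|x'|² + a/|x| ≥ (3/2) (2π)^{2/3} a^{2/3} k^{2/3}`. -/
theorem stmt14 (n k : ℕ) (hn : 1 ≤ n) (hkpos : 1 ≤ k) (a : ℝ) (ha : 0 < a)
    (x x' : ℝ → EuclideanSpace ℝ (Fin n))
    (hper : ∀ t : ℝ, x (t + 1 / k) = x t)
    (hAC : ∀ t ∈ Set.Icc (0:ℝ) 1, x t = x 0 + ∫ s in (0:ℝ)..t, x' s)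
    (hL1 : IntegrableOn x' (Set.Icc (0:ℝ) 1))
    (hL2 : IntegrableOn (fun t => ‖x' t‖ ^ 2) (Set.Icc (0:ℝ) 1))
    (hmean : ∫ t in (0:ℝ)..(1 / k : ℝ), x t = 0) :
    ENNReal.ofReal ((3 / 2) * (2 * π) ^ ((2:ℝ)/3) * a ^ ((2:ℝ)/3) * (k : ℝ) ^ ((2:ℝ)/3))
      ≤ ∫⁻ t in Set.Icc (0:ℝ) 1,
          ENNReal.ofReal ((1 / 2) * ‖x' t‖ ^ 2) + ENNReal.ofReal a / ENNReal.ofReal ‖x t‖ := by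
  set w : ℝ := 2 * π * k with hw
  have hw0 : 0 ≤ w := by positivity
  have hC : (3 / 2) * (2 * π) ^ ((2:ℝ)/3) * a ^ ((2:ℝ)/3) * (k : ℝ) ^ ((2:ℝ)/3)
      = 3 / 2 * (w * a) ^ ((2:ℝ)/3) := by
    rw [hw, Real.mul_rpow (by positivity) ha.le, Real.mul_rpow two_pi_pos.le k.cast_nonneg]
    ring
  have hxc : ContinuousOn x (Set.Icc 0 1) := continuousOn_of_primitive hL1 hAC
  have hxI : IntegrableOn (fun t => w ^ 2 / 2 * ‖x t‖ ^ 2) (Set.Icc (0:ℝ) 1) :=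
    (continuousOn_const.mul (hxc.norm.pow 2)).integrableOn_Icc
  have hx'L : MemLp x' 2 (volume.restrict (Set.Ioc 0 1)) :=
    ((memLp_two_iff_integrable_sq_norm hL1.aestronglyMeasurable).2 hL2).mono_measure
      (Measure.restrict_mono Set.Ioc_subset_Icc_self le_rfl)
  have hW := wirtinger_euclideanSpace_of_periodic (Nat.one_le_iff_ne_zero.1 hkpos) hper hx'L
    hAC hmean
  rw [← hw, intervalIntegral.integral_of_le zero_le_one,
    intervalIntegral.integral_of_le zero_le_one, ← integral_Icc_eq_integral_Ioc,
    ← integral_Icc_eq_integral_Ioc] at hW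
  have hpt : ∀ t, ENNReal.ofReal (3 / 2 * (w * a) ^ ((2:ℝ)/3)) ≤
      ENNReal.ofReal (w ^ 2 / 2 * ‖x t‖ ^ 2) + ENNReal.ofReal a / ENNReal.ofReal ‖x t‖ := by
    intro t
    rcases (norm_nonneg (x t)).eq_or_lt with h0 | h0
    · rw [← h0, ENNReal.ofReal_zero, ENNReal.div_zero (by simpa using ha)]
      simp
    · rw [← ENNReal.ofReal_div_of_pos h0, ← ENNReal.ofReal_add (by positivity) (by positivity)]
      exact ENNReal.ofReal_le_ofReal (three_halves_mul_rpow_le hw0 ha.le h0)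
  calc _ = ∫⁻ _ in Set.Icc (0:ℝ) 1, ENNReal.ofReal (3 / 2 * (w * a) ^ ((2:ℝ)/3)) := by
        rw [hC]; simp
    _ ≤ ∫⁻ t in Set.Icc (0:ℝ) 1,
          (ENNReal.ofReal (w ^ 2 / 2 * ‖x t‖ ^ 2) + ENNReal.ofReal a / ENNReal.ofReal ‖x t‖) :=
        lintegral_mono hpt
    _ = ENNReal.ofReal (∫ t in Set.Icc (0:ℝ) 1, w ^ 2 / 2 * ‖x t‖ ^ 2) +
          ∫⁻ t in Set.Icc (0:ℝ) 1, ENNReal.ofReal a / ENNReal.ofReal ‖x t‖ := by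
        rw [lintegral_add_left' hxI.aestronglyMeasurable.aemeasurable.ennreal_ofReal,
          ofReal_integral_eq_lintegral_ofReal hxI (.of_forall fun t => by positivity)]
    _ ≤ ENNReal.ofReal (∫ t in Set.Icc (0:ℝ) 1, 1 / 2 * ‖x' t‖ ^ 2) +
          ∫⁻ t in Set.Icc (0:ℝ) 1, ENNReal.ofReal a / ENNReal.ofReal ‖x t‖ := by
        gcongr ENNReal.ofReal ?_ + _
        rw [integral_const_mul, integral_const_mul]
        linarith
    _ = _ := by
        have hI := hL2.const_mul (1 / 2)
        rw [lintegral_add_left' hI.aestronglyMeasurable.aemeasurable.ennreal_ofReal,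
          ofReal_integral_eq_lintegral_ofReal hI (.of_forall fun t => by positivity)]
end
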